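/- The language L(∇,•) is strictly less expressive than the language L(□) over the class of all neighborhood models and over each of the classes of (n)-, (r)-, (i)-, (s)-, (b)-, (4)-, and (5)-models: for each such class C, (a) for every L(∇,•)-formula φ there is an L(□)-formula ψ with M,s ⊨ φ ⟺ M,s ⊨ ψ for all M ∈ C and all states s of M, and (b) there is an L(□)-formula φ such that no L(∇,•)-formula ψ satisfies M,s ⊨ φ ⟺ M,s ⊨ ψ for all M ∈ C and all states s of M. -/

import Mathlib

/-- A joint language containing □, ∇ and •; L(∇,•) and L(□) are carved out
below as fragments. -/
inductive Formula : Type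
  | atom : ℕ → Formula
  | neg : Formula → Formula
  | and : Formula → Formula → Formula
  | box : Formula → Formula
  | nabla : Formula → Formula
  | bullet : Formula → Formula

namespace Formula

/-- Membership in the fragment L(∇,•): no occurrence of □. -/
def inNB : Formula → Prop
  | .atom _ => True
  | .neg φ => φ.inNB
  | .and φ ψ => φ.inNB ∧ ψ.inNB
  | .box _ => False
  | .nabla φ => φ.inNB
  | .bullet φ => φ.inNB

/-- Membership in the fragment L(□): no occurrence of ∇ or •. -/
def inBox : Formula → Prop
  | .atom _ => True
  | .neg φ => φ.inBox
  | .and φ ψ => φ.inBox ∧ ψ.inBox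
  | .box φ => φ.inBox
  | .nabla _ => False
  | .bullet _ => False

end Formula

/-- A neighborhood model. -/
structure NbhdModel : Type 1 where
  S : Type
  ne : Nonempty S
  N : S → Set (Set S)
  V : ℕ → Set S

namespace NbhdModel

/-- The truth set ⟦φ⟧_M of a formula in a neighborhood model. -/
def truthSet (M : NbhdModel) : Formula → Set M.S
  | .atom p => M.V p
  | .neg φ => (M.truthSet φ)ᶜ
  | .and φ ψ => M.truthSet φ ∩ M.truthSet ψ
  | .box φ => {s | M.truthSet φ ∈ M.N s}
  | .nabla φ => {s | M.truthSet φ ∉ M.N s ∧ (M.truthSet φ)ᶜ ∉ M.N s}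
  | .bullet φ => {s | s ∈ M.truthSet φ ∧ M.truthSet φ ∉ M.N s}

/-- M,s ⊨ φ. -/
def Sat (M : NbhdModel) (s : M.S) (φ : Formula) : Prop := s ∈ M.truthSet φ

/-- Property (n). -/
def PropN (M : NbhdModel) : Prop := ∀ s : M.S, (Set.univ : Set M.S) ∈ M.N s

/-- Property (r). -/
def PropR (M : NbhdModel) : Prop := ∀ s : M.S, ⋂₀ (M.N s) ∈ M.N s

/-- Property (i). -/
def PropI (M : NbhdModel) : Prop :=
  ∀ (s : M.S) (X Y : Set M.S), X ∈ M.N s → Y ∈ M.N s → X ∩ Y ∈ M.N s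

/-- Property (s). -/
def PropS (M : NbhdModel) : Prop :=
  ∀ (s : M.S) (X Y : Set M.S), X ∈ M.N s → X ⊆ Y → Y ∈ M.N s

/-- Property (b). -/
def PropB (M : NbhdModel) : Prop :=
  ∀ (s : M.S) (X : Set M.S), s ∈ X → {u : M.S | Xᶜ ∉ M.N u} ∈ M.N s

/-- Property (4). -/
def Prop4 (M : NbhdModel) : Prop :=
  ∀ (s : M.S) (X : Set M.S), X ∈ M.N s → {u : M.S | X ∈ M.N u} ∈ M.N s

/-- Property (5). -/
def Prop5 (M : NbhdModel) : Prop :=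
  ∀ (s : M.S) (X : Set M.S), X ∉ M.N s → {u : M.S | X ∉ M.N u} ∈ M.N s

end NbhdModel

/-- L(∇,•) is strictly less expressive than L(□) over the class of models
satisfying C: (a) every L(∇,•)-formula has an L(□) equivalent over the class,
and (b) some L(□)-formula has no L(∇,•) equivalent over the class. -/
def NBStrictlyLessThanBox (C : NbhdModel → Prop) : Prop :=
  (∀ φ : Formula, φ.inNB → ∃ ψ : Formula, ψ.inBox ∧
      ∀ (M : NbhdModel), C M → ∀ s : M.S, (M.Sat s φ ↔ M.Sat s ψ)) ∧
  (∃ φ : Formula, φ.inBox ∧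
      ∀ ψ : Formula, ψ.inNB →
        ¬ ∀ (M : NbhdModel), C M → ∀ s : M.S, (M.Sat s φ ↔ M.Sat s ψ))

/-- Translation of L(∇,•) into L(□). -/
def Formula.toBox : Formula → Formula
  | .atom p => .atom p
  | .neg φ => .neg φ.toBox
  | .and φ ψ => .and φ.toBox ψ.toBox
  | .box φ => .box φ.toBox
  | .nabla φ => .and (.neg (.box φ.toBox)) (.neg (.box (.neg φ.toBox)))
  | .bullet φ => .and φ.toBox (.neg (.box φ.toBox))

theorem Formula.inBox_toBox (φ : Formula) : φ.toBox.inBox := by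
  induction φ <;> simp_all [Formula.toBox, Formula.inBox]

theorem NbhdModel.truthSet_toBox (M : NbhdModel) (φ : Formula) :
    M.truthSet φ.toBox = M.truthSet φ := by
  induction φ with
  | atom p => rfl
  | neg φ ih => simp only [Formula.toBox, truthSet, ih]
  | and φ ψ ih₁ ih₂ => simp only [Formula.toBox, truthSet, ih₁, ih₂]
  | box φ ih => simp only [Formula.toBox, truthSet, ih]
  | nabla φ ih => simp only [Formula.toBox, truthSet, ih]; rfl
  | bullet φ ih => simp only [Formula.toBox, truthSet, ih]; rfl

/-- The one-point model with neighborhood family `𝒩`, all atoms being false. -/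
def NbhdModel.onePoint (𝒩 : Set (Set Unit)) : NbhdModel where
  S := Unit
  ne := inferInstance
  N _ := 𝒩
  V _ := ∅

/-- In a one-point model in which the whole space is a neighborhood, the formulas `∇φ` and `•φ`
are always false, so the truth of L(∇,•)-formulas does not depend on the other neighborhoods. -/
theorem NbhdModel.truthSet_onePoint_eq {𝒩 𝒩' : Set (Set Unit)} (h : Set.univ ∈ 𝒩)
    (h' : Set.univ ∈ 𝒩') {φ : Formula} (hφ : φ.inNB) :
    (onePoint 𝒩).truthSet φ = (onePoint 𝒩').truthSet φ := by
  have nabla_false {𝒩 : Set (Set Unit)} (h : Set.univ ∈ 𝒩) (X : Set Unit) :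
      ¬ (X ∉ 𝒩 ∧ Xᶜ ∉ 𝒩) := by
    rcases Set.eq_empty_or_nonempty X with rfl | hX
    · simp [h]
    · simp [Subsingleton.eq_univ_of_nonempty hX, h]
  have bullet_false {𝒩 : Set (Set Unit)} (h : Set.univ ∈ 𝒩) (X : Set Unit) (s : Unit) :
      ¬ (s ∈ X ∧ X ∉ 𝒩) := by
    rintro ⟨hs, hX⟩
    exact hX (Subsingleton.eq_univ_of_nonempty ⟨s, hs⟩ ▸ h)
  induction φ with
  | atom p => rfl
  | neg φ ih => exact congrArg compl (ih hφ)
  | and φ ψ ih₁ ih₂ => exact congrArg₂ (· ∩ ·) (ih₁ hφ.1) (ih₂ hφ.2)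
  | box φ => exact hφ.elim
  | nabla φ =>
    ext s
    exact iff_of_false (nabla_false h _) (nabla_false h' _)
  | bullet φ =>
    ext s
    exact iff_of_false (bullet_false h _ s) (bullet_false h' _ s)

/-- The formula `□⊥` separates the two one-point models with neighborhood families `{univ}` and
`univ`, which L(∇,•) cannot tell apart. -/
theorem nbStrictlyLessThanBox_of_onePoint {C : NbhdModel → Prop}
    (h₁ : C (.onePoint {Set.univ})) (h₂ : C (.onePoint Set.univ)) :
    NBStrictlyLessThanBox C := by
  refine ⟨fun φ _ => ⟨φ.toBox, φ.inBox_toBox, fun M _ s => ?_⟩,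
    .box (.and (.atom 0) (.neg (.atom 0))), by simp [Formula.inBox], fun ψ hψ h => ?_⟩
  · rw [NbhdModel.Sat, NbhdModel.Sat, M.truthSet_toBox]
  · have hbox₂ : (NbhdModel.onePoint Set.univ).Sat ()
        (.box (.and (.atom 0) (.neg (.atom 0)))) := Set.mem_univ _
    have hψ₁ : (NbhdModel.onePoint {Set.univ}).Sat () ψ := by
      have hψ₂ : () ∈ (NbhdModel.onePoint Set.univ).truthSet ψ := (h _ h₂ ()).1 hbox₂
      exact (NbhdModel.truthSet_onePoint_eq (𝒩' := {Set.univ}) (Set.mem_univ _) rfl hψ).subset hψ₂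
    have hempty : (∅ ∩ ∅ᶜ : Set Unit) = Set.univ := (h _ h₁ ()).2 hψ₁
    exact (hempty.ge (Set.mem_univ ())).1

/-- L(∇,•) is strictly less expressive than L(□) over the class
of all neighborhood models and over the classes of (n)-, (r)-, (i)-, (s)-,
(b)-, (4)-, and (5)-models. -/
theorem nb_strictly_less_expressive_than_box :
    NBStrictlyLessThanBox (fun _ => True) ∧
    NBStrictlyLessThanBox NbhdModel.PropN ∧
    NBStrictlyLessThanBox NbhdModel.PropR ∧
    NBStrictlyLessThanBox NbhdModel.PropI ∧
    NBStrictlyLessThanBox NbhdModel.PropS ∧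
    NBStrictlyLessThanBox NbhdModel.PropB ∧
    NBStrictlyLessThanBox NbhdModel.Prop4 ∧
    NBStrictlyLessThanBox NbhdModel.Prop5 := by
  refine ⟨nbStrictlyLessThanBox_of_onePoint trivial trivial,
    nbStrictlyLessThanBox_of_onePoint (fun _ => rfl) (fun _ => Set.mem_univ _),
    nbStrictlyLessThanBox_of_onePoint (fun _ => Set.sInter_singleton _) (fun _ => Set.mem_univ _),
    nbStrictlyLessThanBox_of_onePoint ?_ (fun _ _ _ _ _ => Set.mem_univ _),
    nbStrictlyLessThanBox_of_onePoint ?_ (fun _ _ _ _ _ => Set.mem_univ _),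
    nbStrictlyLessThanBox_of_onePoint ?_ (fun _ _ _ => Set.mem_univ _),
    nbStrictlyLessThanBox_of_onePoint ?_ (fun _ _ _ => Set.mem_univ _),
    nbStrictlyLessThanBox_of_onePoint ?_ (fun _ _ _ => Set.mem_univ _)⟩
  · rintro _ _ _ rfl rfl
    exact Set.univ_inter _
  · rintro _ _ _ rfl hXY
    exact Set.univ_subset_iff.1 hXY
  · intro s X hs
    exact Set.eq_univ_of_forall fun _ hX => (hX.symm ▸ Set.mem_univ s : s ∈ Xᶜ) hs
  · intro _ _ hX
    exact Set.eq_univ_of_forall fun _ => hX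
  · intro _ _ hX
    exact Set.eq_univ_of_forall fun _ => hX
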